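/- Let k ≥ 2. The super summit set of T_k = δ₃^{3k+1} σ₄^{2k+2} σ₃ σ₄^{2k−1} ∈ B₅, i.e. the set of conjugates of T_k of minimal canonical length, has cardinality at least 2^{2k−2}: there exists an injective map from {1,2}^{2k−2} into the set of y ∈ B₅ that are conjugate to T_k and whose canonical length is minimal among all conjugates of T_k. -/

import Mathlib

/-- Defining relations of the braid group on 5 strands, as elements of the
free group on four generators (generator `i` corresponds to `σ_{i+1}`). -/
def braidRels : Set (FreeGroup (Fin 4)) :=
  { r | (∃ i : Fin 3, r = FreeGroup.of i.castSucc * FreeGroup.of i.succ * FreeGroup.of i.castSucc *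
          (FreeGroup.of i.succ * FreeGroup.of i.castSucc * FreeGroup.of i.succ)⁻¹) ∨
        (∃ i j : Fin 4, 2 ≤ |(i : ℤ) - (j : ℤ)| ∧
          r = FreeGroup.of i * FreeGroup.of j * (FreeGroup.of j * FreeGroup.of i)⁻¹) }

/-- The Artin braid group on 5 strands. -/
abbrev B5 : Type := PresentedGroup braidRels

/-- The Artin generators (index `i` corresponds to `σ_{i+1}`). -/
def gen (i : Fin 4) : B5 := PresentedGroup.of i

def s1 : B5 := gen 0
def s2 : B5 := gen 1
def s3 : B5 := gen 2
def s4 : B5 := gen 3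

/-- A braid is positive if it lies in the submonoid generated by `σ₁,…,σ₄`. -/
def IsPos (x : B5) : Prop := x ∈ Submonoid.closure (Set.range gen)

/-- Prefix order: `Pre x y` means `x ≼ y`, i.e. `x⁻¹ y` is positive. -/
def Pre (x y : B5) : Prop := IsPos (x⁻¹ * y)

/-- The half twist `Δ = σ₁σ₂σ₃σ₄σ₁σ₂σ₃σ₁σ₂σ₁`. -/
def Δ : B5 := s1*s2*s3*s4*s1*s2*s3*s1*s2*s1

def δ3 : B5 := s2*s1
def Δ3 : B5 := s2*s1*s2
def δt3 : B5 := s1*s2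

/-- A braid `s` is simple if `1 ≼ s ≼ Δ`. -/
def IsSimple (s : B5) : Prop := IsPos s ∧ Pre s Δ

/-- Two simple braids `s, t` are left-weighted if no generator `σᵢ` is such that
`s σᵢ` and `σᵢ⁻¹ t` are both simple. -/
def LeftWeighted (s t : B5) : Prop :=
  ¬ ∃ i : Fin 4, IsSimple (s * gen i) ∧ IsSimple ((gen i)⁻¹ * t)

/-- The canonical length of `z`: the minimum of `q - p` over `p ≤ q` with
`Δ^p ≼ z` and `z ≼ Δ^q`. -/
noncomputable def canLen (z : B5) : ℕ :=
  sInf { n : ℕ | ∃ p q : ℤ, p ≤ q ∧ q - p = (n : ℤ) ∧ Pre (Δ ^ p) z ∧ Pre z (Δ ^ q) }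

/-- `y` belongs to the super summit set of `x`:
`y` is conjugate to `x` and has minimal canonical length among conjugates of `x`. -/
def InSSS (x y : B5) : Prop :=
  IsConj x y ∧ ∀ z : B5, IsConj x z → canLen y ≤ canLen z

/-- The braid `T_k = δ₃^{3k+1} σ₄^{2k+2} σ₃ σ₄^{2k-1}`. -/
def T (k : ℕ) : B5 := δ3 ^ (3*k+1) * s4 ^ (2*k+2) * s3 * s4 ^ (2*k-1)

/-- The braid `T'_k`, a rigid conjugate of `T_k`. -/
def T' (k : ℕ) : B5 :=
  (s1*s3)^(2*k-2) * (s3*s4*Δ3) * (Δ3*s4) * ((δ3*s4)*(δt3*s4))^(k-1) * (δ3*s4*s3*s4)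

/-! ### Words in the generators -/

theorem gen_braid (a b : Fin 4) (h : (a : ℕ) + 1 = b) :
    gen a * gen b * gen a = gen b * gen a * gen b := by
  obtain ⟨i, rfl, rfl⟩ : ∃ i : Fin 3, a = i.castSucc ∧ b = i.succ :=
    ⟨⟨a, by omega⟩, by ext; simp, by ext; simp [h]⟩
  have hr := PresentedGroup.one_of_mem (rels := braidRels) (Or.inl ⟨i, rfl⟩)
  rw [map_mul, map_inv, mul_inv_eq_one] at hr
  exact hr

theorem gen_comm (a b : Fin 4) (h : 2 ≤ |(a : ℤ) - (b : ℤ)|) :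
    gen a * gen b = gen b * gen a := by
  have hr := PresentedGroup.one_of_mem (rels := braidRels) (Or.inr ⟨a, b, h, rfl⟩)
  rw [map_mul, map_inv, mul_inv_eq_one] at hr
  exact hr

/-- The braid represented by a positive word. -/
def wordVal (w : List (Fin 4)) : B5 := (w.map gen).prod

theorem wordVal_cons (a : Fin 4) (w : List (Fin 4)) : wordVal (a :: w) = gen a * wordVal w := by
  simp [wordVal]

theorem wordVal_append (u v : List (Fin 4)) : wordVal (u ++ v) = wordVal u * wordVal v := by
  simp [wordVal]

/-- Apply a braid or commutation relation, if there is one, at the start of a word. -/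
def headMove : List (Fin 4) → List (Fin 4)
  | a :: b :: w =>
    if 2 ≤ |(a : ℤ) - (b : ℤ)| then b :: a :: w
    else match w with
      | c :: w' =>
        if a = c ∧ ((a : ℕ) + 1 = b ∨ (b : ℕ) + 1 = a) then b :: a :: b :: w' else a :: b :: w
      | [] => a :: b :: w
  | w => w

/-- Apply a braid or commutation relation, if there is one, at a given position of a word. -/
def moveAt : ℕ → List (Fin 4) → List (Fin 4)
  | 0, w => headMove w
  | n + 1, a :: w => a :: moveAt n w
  | _ + 1, [] => []

theorem wordVal_headMove (w : List (Fin 4)) : wordVal (headMove w) = wordVal w := by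
  unfold headMove
  split
  · rename_i a b w
    split_ifs with h
    · simp only [wordVal_cons, ← mul_assoc, gen_comm a b h]
    · split
      · split_ifs with h'
        · obtain ⟨rfl, h' | h'⟩ := h'
          · simp only [wordVal_cons, ← mul_assoc, gen_braid _ _ h']
          · simp only [wordVal_cons, ← mul_assoc, gen_braid _ _ h']
        · rfl
      · rfl
  · rfl

theorem wordVal_moveAt (n : ℕ) (w : List (Fin 4)) : wordVal (moveAt n w) = wordVal w := by
  induction n generalizing w with
  | zero => exact wordVal_headMove w
  | succ n ih => cases w <;> simp [moveAt, wordVal_cons, ih]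

theorem wordVal_eq_of_moves (ms : List ℕ) (u v : List (Fin 4))
    (h : ms.foldl (fun w n => moveAt n w) u = v) : wordVal u = wordVal v := by
  subst h
  induction ms generalizing u with
  | nil => rfl
  | cons n ms ih => rw [List.foldl_cons, ← ih, wordVal_moveAt]

/-- The defining word of the half twist. -/
def deltaWord : List (Fin 4) := [0, 1, 2, 3, 0, 1, 2, 0, 1, 0]

theorem wordVal_deltaWord : wordVal deltaWord = Δ := by
  simp [wordVal, deltaWord, Δ, s1, s2, s3, s4, mul_assoc]

theorem gen_mul_delta (i : Fin 4) : gen i * Δ = Δ * gen i.rev := by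
  have key : ∀ ms : List ℕ,
      ms.foldl (fun w n => moveAt n w) (i :: deltaWord) = deltaWord ++ [i.rev] →
      gen i * Δ = Δ * gen i.rev := by
    intro ms h
    have := wordVal_eq_of_moves ms _ _ h
    rwa [wordVal_cons, wordVal_append, wordVal_deltaWord, wordVal_cons, wordVal, List.map_nil,
      List.prod_nil, mul_one] at this
  fin_cases i
  · exact key [4, 3, 1, 5, 3, 2, 5, 4, 3, 7, 8, 9] (by decide)
  · exact key [0, 2, 3, 7, 5, 7, 6, 9] (by decide)
  · exact key [0, 1, 3, 4, 6, 8] (by decide)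
  · exact key [0, 1, 2, 4, 5, 7] (by decide)

/-! ### Positive braids and the half twist -/

theorem isPos_one : IsPos 1 := one_mem _

theorem IsPos.mul {x y : B5} (hx : IsPos x) (hy : IsPos y) : IsPos (x * y) := mul_mem hx hy

theorem isPos_gen (i : Fin 4) : IsPos (gen i) := Submonoid.subset_closure ⟨i, rfl⟩

theorem isPos_wordVal (w : List (Fin 4)) : IsPos (wordVal w) := by
  induction w with
  | nil => exact isPos_one
  | cons a w ih => rw [wordVal_cons]; exact (isPos_gen a).mul ih

theorem isPos_delta_pow (n : ℕ) : IsPos (Δ ^ n) :=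
  pow_mem (wordVal_deltaWord ▸ isPos_wordVal _) n

theorem IsPos.conj_delta {x : B5} (hx : IsPos x) : IsPos (Δ⁻¹ * x * Δ) := by
  induction hx using Submonoid.closure_induction with
  | mem x h =>
    obtain ⟨i, rfl⟩ := h
    rw [mul_assoc, gen_mul_delta, inv_mul_cancel_left]
    exact isPos_gen _
  | one => simpa using isPos_one
  | mul x y _ _ hx hy =>
    have : Δ⁻¹ * (x * y) * Δ = (Δ⁻¹ * x * Δ) * (Δ⁻¹ * y * Δ) := by group
    rw [this]
    exact hx.mul hy

theorem IsPos.conj_delta_pow {x : B5} (hx : IsPos x) (n : ℕ) :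
    IsPos ((Δ ^ n)⁻¹ * x * Δ ^ n) := by
  induction n with
  | zero => simpa using hx
  | succ n ih =>
    have : (Δ ^ (n + 1))⁻¹ * x * Δ ^ (n + 1) = Δ⁻¹ * ((Δ ^ n)⁻¹ * x * Δ ^ n) * Δ := by
      rw [pow_succ]; group
    rw [this]
    exact ih.conj_delta

theorem IsPos.conj_delta_inv {x : B5} (hx : IsPos x) : IsPos (Δ * x * Δ⁻¹) := by
  have key : ∀ i, Δ * gen i * Δ⁻¹ = gen i.rev := fun i => by
    rw [mul_inv_eq_iff_eq_mul, gen_mul_delta, Fin.rev_rev]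
  induction hx using Submonoid.closure_induction with
  | mem x h =>
    obtain ⟨i, rfl⟩ := h
    rw [key]
    exact isPos_gen _
  | one => simpa using isPos_one
  | mul x y _ _ hx hy =>
    have : Δ * (x * y) * Δ⁻¹ = (Δ * x * Δ⁻¹) * (Δ * y * Δ⁻¹) := by group
    rw [this]
    exact hx.mul hy

theorem IsPos.conj_delta_zpow {x : B5} (hx : IsPos x) (p : ℤ) :
    IsPos ((Δ ^ p)⁻¹ * x * Δ ^ p) := by
  induction p with
  | zero => simpa using hx
  | succ n ih =>
    have : (Δ ^ ((n : ℤ) + 1))⁻¹ * x * Δ ^ ((n : ℤ) + 1)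
        = Δ⁻¹ * ((Δ ^ (n : ℤ))⁻¹ * x * Δ ^ (n : ℤ)) * Δ := by
      rw [zpow_add_one]; group
    rw [this]
    exact ih.conj_delta
  | pred n ih =>
    have : (Δ ^ (-(n : ℤ) - 1))⁻¹ * x * Δ ^ (-(n : ℤ) - 1)
        = Δ * ((Δ ^ (-(n : ℤ)))⁻¹ * x * Δ ^ (-(n : ℤ))) * Δ⁻¹ := by
      rw [zpow_sub_one]; group
    rw [this]
    exact ih.conj_delta_inv

/-- `z` is an interval element `1 ≼ z ≼ Δ ^ m`. -/
def InInterval (m : ℕ) (z : B5) : Prop := IsPos z ∧ IsPos (z⁻¹ * Δ ^ m)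

theorem InInterval.mul {m n : ℕ} {x y : B5} (hx : InInterval m x) (hy : InInterval n y) :
    InInterval (m + n) (x * y) := by
  refine ⟨hx.1.mul hy.1, ?_⟩
  have : (x * y)⁻¹ * Δ ^ (m + n) = (y⁻¹ * Δ ^ n) * ((Δ ^ n)⁻¹ * (x⁻¹ * Δ ^ m) * Δ ^ n) := by
    rw [pow_add]; group
  rw [this]
  exact hy.2.mul (hx.2.conj_delta_pow n)

theorem inInterval_zero_one : InInterval 0 1 := by
  simp [InInterval, isPos_one]

theorem inInterval_wordVal (u v : List (Fin 4)) (ms : List ℕ)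
    (h : ms.foldl (fun w n => moveAt n w) (u ++ v) = deltaWord) : InInterval 1 (wordVal u) := by
  refine ⟨isPos_wordVal u, ?_⟩
  have := wordVal_eq_of_moves ms _ _ h
  rw [wordVal_append, wordVal_deltaWord] at this
  rw [pow_one, ← this, inv_mul_cancel_left]
  exact isPos_wordVal v

theorem inInterval_gen (i : Fin 4) : InInterval 1 (gen i) := by
  have key : ∀ (v : List (Fin 4)) (ms : List ℕ),
      ms.foldl (fun w n => moveAt n w) ([i] ++ v) = deltaWord →
      InInterval 1 (gen i) := by
    intro v ms h
    simpa [wordVal] using inInterval_wordVal [i] v ms h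
  fin_cases i
  · exact key [1, 0, 2, 1, 0, 3, 2, 1, 0] [2, 5, 4, 3, 6] (by decide)
  · exact key [0, 1, 2, 1, 0, 3, 2, 1, 0] [0, 2, 5, 4, 3, 6] (by decide)
  · exact key [0, 1, 0, 2, 1, 3, 2, 1, 0] [0, 3, 1, 3, 5, 4, 3, 6] (by decide)
  · exact key [0, 1, 0, 2, 1, 0, 3, 2, 1] [0, 1, 2, 6, 5, 3, 2, 3, 7, 5, 7] (by decide)

/-- Every braid is bounded below by a power of the half twist. -/
theorem exists_delta_zpow_pre (z : B5) : ∃ p : ℤ, Pre (Δ ^ p) z := by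
  have hmul : ∀ {x y : B5}, (∃ p : ℤ, Pre (Δ ^ p) x) → (∃ p : ℤ, Pre (Δ ^ p) y) →
      ∃ p : ℤ, Pre (Δ ^ p) (x * y) := by
    rintro x y ⟨p, hp⟩ ⟨r, hr⟩
    refine ⟨p + r, ?_⟩
    have : (Δ ^ (p + r))⁻¹ * (x * y)
        = ((Δ ^ r)⁻¹ * ((Δ ^ p)⁻¹ * x) * Δ ^ r) * ((Δ ^ r)⁻¹ * y) := by
      rw [zpow_add]; group
    unfold Pre
    rw [this]
    exact (hp.conj_delta_zpow r).mul hr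
  have hz : z ∈ Subgroup.closure (Set.range gen) := by
    rw [show Set.range gen = Set.range (PresentedGroup.of (rels := braidRels)) from rfl,
      PresentedGroup.closure_range_of]
    trivial
  induction hz using Subgroup.closure_induction'' with
  | one => exact ⟨0, by simpa [Pre] using isPos_one⟩
  | mem x h =>
    obtain ⟨i, rfl⟩ := h
    exact ⟨0, by simpa [Pre] using isPos_gen i⟩
  | inv_mem x h =>
    obtain ⟨i, rfl⟩ := h
    refine ⟨-1, ?_⟩
    have : (Δ ^ (-1 : ℤ))⁻¹ * (gen i)⁻¹ = Δ * ((gen i)⁻¹ * Δ ^ 1) * Δ⁻¹ := by group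
    unfold Pre
    rw [this]
    exact (inInterval_gen i).2.conj_delta_inv
  | mul x y _ _ hx hy => exact hmul hx hy

theorem Pre.mono_left {p p' : ℤ} {z : B5} (h : Pre (Δ ^ p) z) (hp : p' ≤ p) :
    Pre (Δ ^ p') z := by
  obtain ⟨n, rfl⟩ := Int.le.dest hp
  have : (Δ ^ p')⁻¹ * z = Δ ^ n * ((Δ ^ (p' + n))⁻¹ * z) := by
    rw [← zpow_natCast Δ n, add_comm p', zpow_add]; group
  unfold Pre
  rw [this]
  exact (isPos_delta_pow n).mul h

theorem Pre.mono_right {q q' : ℤ} {z : B5} (h : Pre z (Δ ^ q)) (hq : q ≤ q') :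
    Pre z (Δ ^ q') := by
  obtain ⟨n, rfl⟩ := Int.le.dest hq
  have : z⁻¹ * Δ ^ (q + n) = z⁻¹ * Δ ^ q * Δ ^ n := by
    rw [zpow_add, zpow_natCast, mul_assoc]
  unfold Pre
  rw [this]
  exact h.mul (isPos_delta_pow n)

theorem exists_pre_delta_zpow (z : B5) : ∃ q : ℤ, Pre z (Δ ^ q) := by
  obtain ⟨p, hp⟩ := exists_delta_zpow_pre z⁻¹
  refine ⟨-p, ?_⟩
  have : z⁻¹ * Δ ^ (-p) = (Δ ^ (-p))⁻¹ * ((Δ ^ p)⁻¹ * z⁻¹) * Δ ^ (-p) := by group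
  unfold Pre
  rw [this]
  exact hp.conj_delta_zpow (-p)

theorem canLen_le_of_inInterval {m : ℕ} {z : B5} (h : InInterval m z) : canLen z ≤ m :=
  Nat.sInf_le ⟨0, m, by positivity, by simp, by simpa [Pre] using h.1, by simpa [Pre] using h.2⟩

theorem le_canLen {m : ℕ} {z : B5} (hp : ∀ p : ℤ, Pre (Δ ^ p) z → p ≤ 0)
    (hq : ∀ q : ℤ, Pre z (Δ ^ q) → m ≤ q) : m ≤ canLen z := by
  refine le_csInf ?_ ?_
  · obtain ⟨p, hp⟩ := exists_delta_zpow_pre z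
    obtain ⟨q, hq⟩ := exists_pre_delta_zpow z
    exact ⟨(q - min p q).toNat, min p q, q, min_le_right _ _,
      by rw [Int.toNat_of_nonneg (sub_nonneg.2 (min_le_right _ _))],
      hp.mono_left (min_le_left _ _), hq⟩
  · rintro n ⟨p, q, -, hn, h1, h2⟩
    have := hp p h1
    have := hq q h2
    omega

/-! ### Matrix representations -/

theorem mapMatrix_smul {m : ℕ} (c : ℤ) (A : Matrix (Fin m) (Fin m) ℤ) :
    (Int.castRingHom ℚ).mapMatrix (c • A) = (c : ℚ) • (Int.castRingHom ℚ).mapMatrix A := by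
  ext i j
  rw [RingHom.mapMatrix_apply, Matrix.map_apply, Matrix.smul_apply, Matrix.smul_apply, smul_eq_mul,
    smul_eq_mul, map_mul]
  rfl

/-- Integer matrices that satisfy the braid relations and are invertible over `ℚ` define a
representation of the braid group. -/
theorem exists_rep {m : ℕ} (S N : Fin 4 → Matrix (Fin m) (Fin m) ℤ) (c : ℤ) (hc : c ≠ 0)
    (hSN : ∀ i, S i * N i = c • (1 : Matrix (Fin m) (Fin m) ℤ))
    (hbraid : ∀ i : Fin 3, S i.castSucc * S i.succ * S i.castSucc =
      S i.succ * S i.castSucc * S i.succ)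
    (hcomm : ∀ i j : Fin 4, 2 ≤ |(i : ℤ) - (j : ℤ)| → S i * S j = S j * S i) :
    ∃ ρ : B5 →* Matrix (Fin m) (Fin m) ℚ,
      ∀ i, ρ (gen i) = (Int.castRingHom ℚ).mapMatrix (S i) := by
  have hc' : (c : ℚ) ≠ 0 := by exact_mod_cast hc
  have hinv : ∀ i, (Int.castRingHom ℚ).mapMatrix (S i) *
      ((c : ℚ)⁻¹ • (Int.castRingHom ℚ).mapMatrix (N i)) = 1 := by
    intro i
    rw [mul_smul_comm, ← map_mul, hSN, mapMatrix_smul, map_one, smul_smul, inv_mul_cancel₀ hc',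
      one_smul]
  let U : Fin 4 → (Matrix (Fin m) (Fin m) ℚ)ˣ := fun i =>
    ⟨_, _, hinv i, mul_eq_one_comm.1 (hinv i)⟩
  have hU : ∀ i, (U i : Matrix (Fin m) (Fin m) ℚ) = (Int.castRingHom ℚ).mapMatrix (S i) :=
    fun _ => rfl
  have hrel : ∀ r ∈ braidRels, FreeGroup.lift U r = 1 := by
    rintro r (⟨i, rfl⟩ | ⟨i, j, hij, rfl⟩)
    · simp only [map_mul, map_inv, FreeGroup.lift_apply_of, mul_inv_eq_one]
      ext1
      simp only [Units.val_mul, hU, ← map_mul, hbraid]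
    · simp only [map_mul, map_inv, FreeGroup.lift_apply_of, mul_inv_eq_one]
      ext1
      simp only [Units.val_mul, hU, ← map_mul, hcomm i j hij]
  exact ⟨(Units.coeHom _).comp (PresentedGroup.toGroup hrel), fun i => by
    simp [gen, PresentedGroup.toGroup.of, hU]⟩

/-- Representations by integer matrices are integral on positive braids. -/
theorem IsPos.exists_int_matrix {m : ℕ} {S : Fin 4 → Matrix (Fin m) (Fin m) ℤ}
    {ρ : B5 →* Matrix (Fin m) (Fin m) ℚ}
    (hρ : ∀ i, ρ (gen i) = (Int.castRingHom ℚ).mapMatrix (S i)) {x : B5} (hx : IsPos x) :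
    ∃ A : Matrix (Fin m) (Fin m) ℤ, ρ x = (Int.castRingHom ℚ).mapMatrix A := by
  induction hx using Submonoid.closure_induction with
  | mem x h =>
    obtain ⟨i, rfl⟩ := h
    exact ⟨S i, hρ i⟩
  | one => exact ⟨1, by rw [map_one, map_one]⟩
  | mul x y _ _ hx hy =>
    obtain ⟨A, hA⟩ := hx
    obtain ⟨B, hB⟩ := hy
    exact ⟨A * B, by rw [map_mul, map_mul, hA, hB]⟩

theorem trace_eq_of_isConj {m : ℕ} (ρ : B5 →* Matrix (Fin m) (Fin m) ℚ) {x y : B5}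
    (h : IsConj x y) : (ρ x).trace = (ρ y).trace := by
  obtain ⟨c, rfl⟩ := isConj_iff.1 h
  rw [map_mul, Matrix.trace_mul_comm, ← map_mul]
  simp

theorem trace_mapMatrix {R : Type*} [CommRing R] {m : ℕ} (A : Matrix (Fin m) (Fin m) ℤ) :
    ((Int.castRingHom R).mapMatrix A).trace = (A.trace : R) := by
  rw [RingHom.mapMatrix_apply, ← AddMonoidHom.map_trace]
  rfl

/-- The Lawrence–Krammer–Bigelow matrices of the generators, with parameters `q` and `t`,
in the basis `x₁₂, x₁₃, x₁₄, x₁₅, x₂₃, x₂₄, x₂₅, x₃₄, x₃₅, x₄₅`. -/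
def lkb (q t : ℤ) : Fin 4 → Matrix (Fin 10) (Fin 10) ℤ :=
  ![!![t*q^2, t*q*(q-1), t*q*(q-1), t*q*(q-1), 0, 0, 0, 0, 0, 0;
       0, 0, 0, 0, 1, 0, 0, 0, 0, 0;
       0, 0, 0, 0, 0, 1, 0, 0, 0, 0;
       0, 0, 0, 0, 0, 0, 1, 0, 0, 0;
       0, q, 0, 0, 1-q, 0, 0, 0, 0, 0;
       0, 0, q, 0, 0, 1-q, 0, 0, 0, 0;
       0, 0, 0, q, 0, 0, 1-q, 0, 0, 0;
       0, 0, 0, 0, 0, 0, 0, 1, 0, 0;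
       0, 0, 0, 0, 0, 0, 0, 0, 1, 0;
       0, 0, 0, 0, 0, 0, 0, 0, 0, 1],
    !![1-q, 1, 0, 0, 0, 0, 0, 0, 0, 0;
       q, 0, 0, 0, 0, 0, 0, 0, 0, 0;
       0, 0, 1, 0, 0, 0, 0, 0, 0, 0;
       0, 0, 0, 1, 0, 0, 0, 0, 0, 0;
       0, t*q^2*(q-1), t*q*(q-1)^2, t*q*(q-1)^2, t*q^2, t*q*(q-1), t*q*(q-1), 0, 0, 0;
       0, 0, 0, 0, 0, 0, 0, 1, 0, 0;
       0, 0, 0, 0, 0, 0, 0, 0, 1, 0;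
       0, 0, 0, 0, 0, q, 0, 1-q, 0, 0;
       0, 0, 0, 0, 0, 0, q, 0, 1-q, 0;
       0, 0, 0, 0, 0, 0, 0, 0, 0, 1],
    !![1, 0, 0, 0, 0, 0, 0, 0, 0, 0;
       0, 1-q, 1, 0, 0, 0, 0, 0, 0, 0;
       0, q, 0, 0, 0, 0, 0, 0, 0, 0;
       0, 0, 0, 1, 0, 0, 0, 0, 0, 0;
       0, 0, 0, 0, 1-q, 1, 0, 0, 0, 0;
       0, 0, 0, 0, q, 0, 0, 0, 0, 0;
       0, 0, 0, 0, 0, 0, 1, 0, 0, 0;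
       0, 0, t*q^3*(q-1), t*q^2*(q-1)^2, 0, t*q^2*(q-1), t*q*(q-1)^2, t*q^2, t*q*(q-1), 0;
       0, 0, 0, 0, 0, 0, 0, 0, 0, 1;
       0, 0, 0, 0, 0, 0, 0, 0, q, 1-q],
    !![1, 0, 0, 0, 0, 0, 0, 0, 0, 0;
       0, 1, 0, 0, 0, 0, 0, 0, 0, 0;
       0, 0, 1-q, 1, 0, 0, 0, 0, 0, 0;
       0, 0, q, 0, 0, 0, 0, 0, 0, 0;
       0, 0, 0, 0, 1, 0, 0, 0, 0, 0;
       0, 0, 0, 0, 0, 1-q, 1, 0, 0, 0;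
       0, 0, 0, 0, 0, q, 0, 0, 0, 0;
       0, 0, 0, 0, 0, 0, 0, 1-q, 1, 0;
       0, 0, 0, 0, 0, 0, 0, q, 0, 0;
       0, 0, 0, t*q^4*(q-1), 0, 0, t*q^3*(q-1), 0, t*q^2*(q-1), t*q^2]]

/-! ### The half twist does not divide a conjugate of `T k` -/

theorem exists_lkb_rep_two_eight : ∃ ρ : B5 →* Matrix (Fin 10) (Fin 10) ℚ,
    ∀ i, ρ (gen i) = (Int.castRingHom ℚ).mapMatrix (lkb 2 8 i) :=
  exists_rep (lkb 2 8)
    (fun i => lkb 2 8 i * lkb 2 8 i - (31 : ℤ) • lkb 2 8 i - (34 : ℤ) • 1) (-64)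
    (by norm_num) (by decide +kernel) (by decide +kernel) (by decide +kernel)

theorem trace_lkb_two_eight_T (k : ℕ) (hk : 2 ≤ k) :
    ((((lkb 2 8 1 * lkb 2 8 0) ^ (3*k+1) * lkb 2 8 3 ^ (2*k+2) * lkb 2 8 2 *
      lkb 2 8 3 ^ (2*k-1)).trace : ℤ) : ZMod 8) = 4 := by
  rw [← trace_mapMatrix]
  set π := (Int.castRingHom (ZMod 8)).mapMatrix (m := Fin 10)
  have h1 : IsIdempotentElem (π ((lkb 2 8 1 * lkb 2 8 0) ^ 3)) := by
    rw [IsIdempotentElem, ← map_mul]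
    decide +kernel
  have h2 : ∀ m, π (lkb 2 8 3) ^ (m + 3) = π (lkb 2 8 3 ^ 3) := by
    intro m
    induction m with
    | zero => rw [map_pow]
    | succ m ih =>
      rw [add_right_comm, pow_succ, ih, ← map_mul]
      decide +kernel
  obtain ⟨k, rfl⟩ : ∃ j, k = j + 2 := ⟨k - 2, by omega⟩
  rw [map_mul, map_mul, map_mul, pow_succ, pow_mul, map_mul, map_pow,
    show k + 2 = (k + 1) + 1 by rfl, h1.pow_succ_eq, map_pow π (lkb 2 8 3), map_pow π (lkb 2 8 3),
    show 2 * (k + 1 + 1) + 2 = (2 * k + 3) + 3 by ring, h2,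
    show 2 * (k + 1 + 1) - 1 = 2 * k + 3 by omega, h2]
  simp only [← map_mul]
  decide +kernel

theorem Pre.nonpos_of_isConj_T {k : ℕ} (hk : 2 ≤ k) {z : B5} (hz : IsConj (T k) z) {p : ℤ}
    (h : Pre (Δ ^ p) z) : p ≤ 0 := by
  by_contra! hp
  obtain ⟨ρ, hρ⟩ := exists_lkb_rep_two_eight
  obtain ⟨A, hA⟩ := (h.mono_left (show (1 : ℤ) ≤ p by omega)).exists_int_matrix hρ
  have hD : ρ Δ = (Int.castRingHom ℚ).mapMatrix (((lkb 2 8 0 * lkb 2 8 1 * lkb 2 8 2 * lkb 2 8 3) *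
      (lkb 2 8 0 * lkb 2 8 1 * lkb 2 8 2)) * (lkb 2 8 0 * lkb 2 8 1 * lkb 2 8 0)) := by
    simp only [Δ, s1, s2, s3, s4, map_mul, hρ, mul_assoc]
  have hzA := congrArg (ρ Δ * ·) hA
  simp only [hD] at hzA
  rw [← hD, ← map_mul, zpow_one, mul_inv_cancel_left, hD, ← map_mul] at hzA
  have hT : ρ (T k) = (Int.castRingHom ℚ).mapMatrix ((lkb 2 8 1 * lkb 2 8 0) ^ (3*k+1) *
      lkb 2 8 3 ^ (2*k+2) * lkb 2 8 2 * lkb 2 8 3 ^ (2*k-1)) := by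
    simp only [T, δ3, s1, s2, s3, s4, map_mul, map_pow, hρ]
  have htr := trace_eq_of_isConj ρ hz
  rw [hT, hzA, trace_mapMatrix, trace_mapMatrix, Int.cast_inj] at htr
  have h4 := trace_lkb_two_eight_T k hk
  rw [htr, ← trace_mapMatrix, map_mul] at h4
  rw [show (Int.castRingHom (ZMod 8)).mapMatrix (((lkb 2 8 0 * lkb 2 8 1 * lkb 2 8 2 *
      lkb 2 8 3) * (lkb 2 8 0 * lkb 2 8 1 * lkb 2 8 2)) * (lkb 2 8 0 * lkb 2 8 1 * lkb 2 8 0)) = 0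
      by decide +kernel, zero_mul, Matrix.trace_zero] at h4
  exact absurd h4 (by decide)

/-! ### Conjugates of `T k` do not divide a small power of the half twist -/

/-- A conjugate of `T k`, for `n = 2 * k - 2`. -/
def base (n : ℕ) : B5 :=
  wordVal [1, 0, 2, 3, 2] * wordVal [0, 2, 1, 0, 3] * (Δ3 ^ (n+1) * s4 ^ (2*n+1))

theorem commute_Δ3_s4 : Commute Δ3 s4 := by
  have h1 : Commute s1 s4 := gen_comm 0 3 (by decide)
  have h2 : Commute s2 s4 := gen_comm 1 3 (by decide)
  exact (h2.mul_left h1).mul_left h2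

theorem exists_lkb_rep_neg_one_three : ∃ ρ : B5 →* Matrix (Fin 10) (Fin 10) ℚ,
    ∀ i, ρ (gen i) = (Int.castRingHom ℚ).mapMatrix (lkb (-1) 3 i) :=
  exists_rep (lkb (-1) 3)
    (fun i => lkb (-1) 3 i * lkb (-1) 3 i - (5 : ℤ) • lkb (-1) 3 i + (7 : ℤ) • 1) 3
    (by norm_num) (by decide +kernel) (by decide +kernel) (by decide +kernel)

/-- The image of the half twist for the parameters `q = -1`, `t = 3`, divided by `3`. -/
def lkbDelta : Matrix (Fin 10) (Fin 10) ℤ :=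
  !![0, 0, 0, 0, 0, 0, 0, 0, 0, 1;
     0, 0, 0, 0, 0, 0, 0, 0, -1, 0;
     0, 0, 0, 0, 0, 0, 1, 0, 0, 0;
     0, 0, 0, -1, 0, 0, 0, 0, 0, 0;
     0, 0, 0, 0, 0, 0, 0, 1, 0, 0;
     0, 0, 0, 0, 0, -1, 0, 0, 0, 0;
     0, 0, 1, 0, 0, 0, 0, 0, 0, 0;
     0, 0, 0, 0, 1, 0, 0, 0, 0, 0;
     0, -1, 0, 0, 0, 0, 0, 0, 0, 0;
     1, 0, 0, 0, 0, 0, 0, 0, 0, 0]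

theorem exists_inverse_base (n : ℕ) (hn : 1 ≤ n) {ρ : B5 →* Matrix (Fin 10) (Fin 10) ℚ}
    (hρ : ∀ i, ρ (gen i) = (Int.castRingHom ℚ).mapMatrix (lkb (-1) 3 i)) :
    ∃ R : Matrix (Fin 10) (Fin 10) ℤ, (3 : ℚ) ^ (2*n+3) • ρ (base n)⁻¹ =
      (Int.castRingHom ℚ).mapMatrix R ∧ (R.trace : ZMod 3) = 2 := by
  set S := lkb (-1) 3
  set ι := (Int.castRingHom ℚ).mapMatrix (m := Fin 10)
  have hsmul : ∀ (m : ℕ) (A : Matrix (Fin 10) (Fin 10) ℤ), ι ((3 : ℤ) ^ m • A) =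
      (3 : ℚ) ^ m • ι A := by
    intro m A
    rw [mapMatrix_smul, Int.cast_pow, Int.cast_ofNat]
  have hinv : ∀ {m : ℕ} {x : B5} {A B : Matrix (Fin 10) (Fin 10) ℤ}, ρ x = ι A →
      A * B = (3 : ℤ) ^ m • (1 : Matrix (Fin 10) (Fin 10) ℤ) → (3 : ℚ) ^ m • ρ x⁻¹ = ι B := by
    intro m x A B hA hAB
    have : ρ x * ι B = (3 : ℚ) ^ m • 1 := by rw [hA, ← map_mul, hAB, hsmul, map_one]
    rw [← mul_one (ρ x⁻¹), ← mul_smul_comm, ← this, ← mul_assoc, ← map_mul, inv_mul_cancel,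
      map_one, one_mul]
  have hmul : ∀ {a b : ℕ} {x y : B5} {A B : Matrix (Fin 10) (Fin 10) ℤ},
      (3 : ℚ) ^ a • ρ x = ι A → (3 : ℚ) ^ b • ρ y = ι B →
      (3 : ℚ) ^ (a + b) • ρ (x * y) = ι (A * B) := by
    intro a b x y A B hA hB
    rw [map_mul, map_mul, ← hA, ← hB, smul_mul_smul_comm, pow_add]
  have hpow : ∀ {x : B5} {A : Matrix (Fin 10) (Fin 10) ℤ} (m : ℕ),
      (3 : ℚ) ^ 1 • ρ x = ι A → (3 : ℚ) ^ m • ρ (x ^ m) = ι (A ^ m) := by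
    intro x A m hA
    rw [map_pow, map_pow, ← hA, smul_pow, pow_one]
  let P := S 3 * S 3 - (5 : ℤ) • S 3 + (7 : ℤ) • 1
  let Q := S 2 * S 1 * S 0 * S 3 * S 2 * S 1 * lkbDelta
  let M := S 2 * S 1 * S 0 * S 3 * S 2 * lkbDelta * (S 1 * S 0 * S 2 * S 1 * S 3 * lkbDelta)
  have hP : (3 : ℚ) ^ 1 • ρ s4⁻¹ = ι P := hinv (hρ 3) (by decide +kernel)
  have hQ : (3 : ℚ) ^ 1 • ρ (Δ3 * s4)⁻¹ = ι Q := by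
    refine hinv (A := S 1 * S 0 * S 1 * S 3) ?_ (by decide +kernel)
    simp only [Δ3, s1, s2, s4, map_mul, hρ, S, ι]
  have hM : (3 : ℚ) ^ 2 • ρ (wordVal [1, 0, 2, 3, 2] * wordVal [0, 2, 1, 0, 3])⁻¹ = ι M := by
    refine hinv (A := S 1 * S 0 * S 2 * S 3 * S 2 * (S 0 * S 2 * S 1 * S 0 * S 3)) ?_
      (by decide +kernel)
    simp only [wordVal, List.map_cons, List.map_nil, List.prod_cons, List.prod_nil, mul_one,
      map_mul, hρ, S, ι, mul_assoc]
  have hbase : (base n)⁻¹ = (Δ3 * s4)⁻¹ ^ (n+1) * s4⁻¹ ^ n *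
      (wordVal [1, 0, 2, 3, 2] * wordVal [0, 2, 1, 0, 3])⁻¹ := by
    rw [base, mul_inv_rev, inv_pow, inv_pow, ← mul_inv_rev (s4 ^ n), commute_Δ3_s4.mul_pow,
      ← mul_assoc, (commute_Δ3_s4.pow_pow (n+1) n).eq.symm, mul_assoc, ← pow_add,
      show n + (n + 1) = 2 * n + 1 by ring]
  refine ⟨Q ^ (n+1) * P ^ n * M, ?_, ?_⟩
  · rw [hbase, show 2 * n + 3 = (n + 1) + n + 2 by ring]
    exact hmul (hmul (hpow _ hQ) (hpow _ hP)) hM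
  · rw [← trace_mapMatrix]
    set π := (Int.castRingHom (ZMod 3)).mapMatrix (m := Fin 10)
    have hPP : IsIdempotentElem (π P) := by
      rw [IsIdempotentElem, ← map_mul]
      decide +kernel
    have hQP : ∀ m, π Q ^ m * π P = π P := by
      intro m
      induction m with
      | zero => rw [pow_zero, one_mul]
      | succ m ih =>
        rw [pow_succ, mul_assoc, ← map_mul,
          show π (Q * P) = π P by decide +kernel, ih]
    obtain ⟨n, rfl⟩ := Nat.exists_eq_add_of_le' hn
    rw [map_mul, map_mul, map_pow, map_pow, hPP.pow_succ_eq, hQP, ← map_mul]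
    decide +kernel

theorem le_of_isConj_base_of_pre {n : ℕ} (hn : 1 ≤ n) {z : B5} (hz : IsConj (base n) z) {q : ℤ}
    (h : Pre z (Δ ^ q)) : ((2 * n + 3 : ℕ) : ℤ) ≤ q := by
  by_contra! hq
  obtain ⟨ρ, hρ⟩ := exists_lkb_rep_neg_one_three
  obtain ⟨R, hR, htr⟩ := exists_inverse_base n hn hρ
  have hpos : IsPos (z⁻¹ * (Δ ^ 2) ^ (n + 1)) := by
    have := h.mono_right (show q ≤ ((2 * (n + 1) : ℕ) : ℤ) by omega)
    rwa [Pre, zpow_natCast, pow_mul] at this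
  obtain ⟨A, hA⟩ := hpos.exists_int_matrix hρ
  have hD : ρ (Δ ^ 2) = (9 : ℚ) • 1 := by
    have : ρ Δ = (Int.castRingHom ℚ).mapMatrix ((3 : ℤ) • lkbDelta) := by
      rw [show (3 : ℤ) • lkbDelta = (lkb (-1) 3 0 * lkb (-1) 3 1 * lkb (-1) 3 2 * lkb (-1) 3 3) *
        (lkb (-1) 3 0 * lkb (-1) 3 1 * lkb (-1) 3 2) *
        (lkb (-1) 3 0 * lkb (-1) 3 1 * lkb (-1) 3 0) by decide +kernel]
      simp only [Δ, s1, s2, s3, s4, map_mul, hρ, mul_assoc]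
    rw [map_pow, this, ← map_pow, show ((3 : ℤ) • lkbDelta) ^ 2 = (9 : ℤ) • 1 by decide +kernel,
      mapMatrix_smul, map_one, Int.cast_ofNat]
  have hzA : (9 : ℚ) ^ (n + 1) • ρ z⁻¹ = (Int.castRingHom ℚ).mapMatrix A := by
    rw [← hA, map_mul, map_pow, hD, smul_pow, one_pow, mul_smul_comm, mul_one]
  have hz' : IsConj (base n)⁻¹ z⁻¹ := by
    obtain ⟨c, rfl⟩ := isConj_iff.1 hz
    exact isConj_iff.2 ⟨c, by group⟩
  have h1 : (R.trace : ℚ) = 3 * A.trace := by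
    rw [← trace_mapMatrix, ← trace_mapMatrix, ← hR, ← hzA, Matrix.trace_smul, Matrix.trace_smul,
      trace_eq_of_isConj ρ hz', smul_eq_mul, smul_eq_mul,
      show 2 * n + 3 = 2 * (n + 1) + 1 by ring, pow_succ, pow_mul]
    ring
  have h2 : R.trace = 3 * A.trace := by exact_mod_cast h1
  rw [h2, Int.cast_mul] at htr
  exact absurd htr (by rw [show ((3 : ℤ) : ZMod 3) = 0 by decide, zero_mul]; decide)

/-! ### The family of conjugates -/

/-- The generator `σ₁` or `σ₂`. -/
def sg (f : Bool) : Fin 4 := if f then 0 else 1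

/-- The positive braids on three strands by which the family is conjugated. -/
def conjugator : Bool → List Bool → B5
  | _, [] => 1
  | f, true :: v => gen (sg f) * conjugator f v
  | f, false :: v => gen (sg f) * gen (sg !f) * conjugator (!f) v

/-- The complement of `conjugator f v` in the power of `Δ3` with exponent the length of `v`. -/
def complement : Bool → List Bool → B5
  | _, [] => 1
  | f, true :: v => complement (!f) v * (gen (sg f) * gen (sg !f))
  | f, false :: v => complement f v * gen (sg !f)

theorem commute_gen_sg_s4 (f : Bool) : Commute (gen (sg f)) s4 := by
  cases f
  · exact gen_comm 1 3 (by decide)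
  · exact gen_comm 0 3 (by decide)

theorem commute_conjugator_s4 (f : Bool) (v : List Bool) : Commute (conjugator f v) s4 := by
  induction v generalizing f with
  | nil => exact Commute.one_left _
  | cons b v ih =>
    cases b
    · exact ((commute_gen_sg_s4 f).mul_left (commute_gen_sg_s4 !f)).mul_left (ih !f)
    · exact (commute_gen_sg_s4 f).mul_left (ih f)

theorem commute_complement_s4 (f : Bool) (v : List Bool) : Commute (complement f v) s4 := by
  induction v generalizing f with
  | nil => exact Commute.one_left _
  | cons b v ih =>
    cases b
    · exact (ih f).mul_left (commute_gen_sg_s4 !f)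
    · exact (ih !f).mul_left ((commute_gen_sg_s4 f).mul_left (commute_gen_sg_s4 !f))

theorem gen_sg_mul (f : Bool) : gen (sg f) * gen (sg !f) * gen (sg f) = Δ3 := by
  cases f
  · rfl
  · exact gen_braid 0 1 rfl

theorem Δ3_mul_gen_sg (f : Bool) : Δ3 * gen (sg f) = gen (sg !f) * Δ3 := by
  conv_lhs => rw [← gen_sg_mul (!f)]
  conv_rhs => rw [← gen_sg_mul f]
  simp only [Bool.not_not, mul_assoc]

theorem Δ3_mul_conjugator (f : Bool) (v : List Bool) :
    Δ3 * conjugator f v = conjugator (!f) v * Δ3 := by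
  induction v generalizing f with
  | nil => simp [conjugator]
  | cons b v ih =>
    cases b
    · rw [conjugator, conjugator, ← mul_assoc, ← mul_assoc, Δ3_mul_gen_sg, mul_assoc _ Δ3,
        Δ3_mul_gen_sg, mul_assoc, mul_assoc _ Δ3, ih]
      simp only [mul_assoc]
    · rw [conjugator, conjugator, ← mul_assoc, Δ3_mul_gen_sg, mul_assoc, ih, mul_assoc]

theorem complement_mul_conjugator (f : Bool) (v : List Bool) :
    complement f v * conjugator f v = Δ3 ^ v.length := by
  induction v generalizing f with
  | nil => simp [complement, conjugator]
  | cons b v ih =>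
    cases b
    · calc complement f v * gen (sg !f) * (gen (sg f) * gen (sg !f) * conjugator (!f) v)
          = complement f v * ((gen (sg !f) * gen (sg !!f) * gen (sg !f)) *
              conjugator (!f) v) := by simp only [Bool.not_not, mul_assoc]
        _ = complement f v * conjugator f v * Δ3 := by
            rw [gen_sg_mul, Δ3_mul_conjugator, Bool.not_not, mul_assoc]
        _ = Δ3 ^ (v.length + 1) := by rw [ih, pow_succ]
    · calc complement (!f) v * (gen (sg f) * gen (sg !f)) * (gen (sg f) * conjugator f v)
          = complement (!f) v * ((gen (sg f) * gen (sg !f) * gen (sg f)) * conjugator f v) := by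
            simp only [mul_assoc]
        _ = complement (!f) v * conjugator (!f) v * Δ3 := by
            rw [gen_sg_mul, Δ3_mul_conjugator, mul_assoc]
        _ = Δ3 ^ (v.length + 1) := by rw [ih, pow_succ]

theorem inInterval_gen_sg_mul_s4 (f : Bool) : InInterval 1 (gen (sg f) * s4) := by
  have key : ∀ (a : Fin 4) (v : List (Fin 4)) (ms : List ℕ),
      ms.foldl (fun w n => moveAt n w) ([a, 3] ++ v) = deltaWord → InInterval 1 (gen a * s4) := by
    intro a v ms h
    simpa [wordVal, s4] using inInterval_wordVal [a, 3] v ms h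
  cases f
  · exact key 1 [0, 1, 2, 1, 0, 3, 2, 1] [1, 2, 0, 6, 5, 3, 2, 3, 7, 5, 7] (by decide)
  · exact key 0 [1, 0, 2, 1, 0, 3, 2, 1] [1, 2, 6, 5, 3, 2, 3, 7, 5, 7] (by decide)

theorem inInterval_gen_sg_mul_gen_sg_mul_s4 (f : Bool) :
    InInterval 1 (gen (sg f) * gen (sg !f) * s4) := by
  have key : ∀ (a b : Fin 4) (v : List (Fin 4)) (ms : List ℕ),
      ms.foldl (fun w n => moveAt n w) ([a, b, 3] ++ v) = deltaWord →
      InInterval 1 (gen a * gen b * s4) := by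
    intro a b v ms h
    simpa [wordVal, s4, mul_assoc] using inInterval_wordVal [a, b, 3] v ms h
  cases f
  · exact key 1 0 [1, 2, 1, 0, 3, 2, 1] [2, 0, 6, 5, 3, 2, 3, 7, 5, 7] (by decide)
  · exact key 0 1 [0, 2, 1, 0, 3, 2, 1] [2, 6, 5, 3, 2, 3, 7, 5, 7] (by decide)

theorem inInterval_conjugator (f : Bool) (v : List Bool) :
    InInterval v.length (conjugator f v * s4 ^ v.length) := by
  induction v generalizing f with
  | nil => simpa [conjugator] using inInterval_zero_one
  | cons b v ih =>
    rw [List.length_cons, add_comm]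
    have hc : ∀ x f, x * conjugator f v * s4 ^ (1 + v.length) =
        x * s4 * (conjugator f v * s4 ^ v.length) := by
      intro x f
      rw [pow_add, pow_one, ← mul_assoc, mul_assoc x, (commute_conjugator_s4 f v).eq]
      simp only [mul_assoc]
    cases b
    · rw [conjugator, hc]
      exact (inInterval_gen_sg_mul_gen_sg_mul_s4 f).mul (ih _)
    · rw [conjugator, hc]
      exact (inInterval_gen_sg_mul_s4 f).mul (ih _)

theorem inInterval_complement (f : Bool) (v : List Bool) :
    InInterval v.length (complement f v * s4 ^ v.length) := by
  induction v generalizing f with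
  | nil => simpa [complement] using inInterval_zero_one
  | cons b v ih =>
    rw [List.length_cons]
    have hc : ∀ x f, Commute x s4 → complement f v * x * s4 ^ (v.length + 1) =
        complement f v * s4 ^ v.length * (x * s4) := by
      intro x f hx
      rw [pow_succ, ← mul_assoc, mul_assoc _ x, (hx.pow_right _).eq]
      simp only [mul_assoc]
    cases b
    · rw [complement, hc _ _ (commute_gen_sg_s4 _)]
      exact (ih _).mul (inInterval_gen_sg_mul_s4 _)
    · rw [complement, hc _ _ ((commute_gen_sg_s4 _).mul_left (commute_gen_sg_s4 _))]
      exact (ih _).mul (inInterval_gen_sg_mul_gen_sg_mul_s4 f)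

/-- The family of conjugates of minimal canonical length. -/
def family (n : ℕ) (v : List Bool) : B5 :=
  conjugator true v * s4 ^ n * base n * (conjugator true v * s4 ^ n)⁻¹

theorem inInterval_family (v : List Bool) :
    InInterval (2 * v.length + 3) (family v.length v) := by
  have h : family v.length v = conjugator true v * s4 ^ v.length * wordVal [1, 0, 2, 3, 2] *
      wordVal [0, 2, 1, 0, 3] * wordVal [1, 0, 1, 3] * (complement true v * s4 ^ v.length) := by
    have h1 : wordVal [1, 0, 1, 3] = Δ3 * s4 := by
      simp [wordVal, Δ3, s1, s2, s4, mul_assoc]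
    have h2 : Δ3 ^ (v.length + 1) * (conjugator true v)⁻¹ = Δ3 * complement true v := by
      rw [mul_inv_eq_iff_eq_mul, mul_assoc, complement_mul_conjugator, pow_succ']
    rw [family, base, mul_inv_rev, h1]
    calc _ = conjugator true v * s4 ^ v.length * wordVal [1, 0, 2, 3, 2] *
          wordVal [0, 2, 1, 0, 3] * (Δ3 ^ (v.length + 1) *
          (s4 ^ (v.length + 1) * (conjugator true v)⁻¹)) := by
          rw [show 2 * v.length + 1 = (v.length + 1) + v.length by ring, pow_add s4]
          group
      _ = conjugator true v * s4 ^ v.length * wordVal [1, 0, 2, 3, 2] *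
          wordVal [0, 2, 1, 0, 3] * (Δ3 * (complement true v * s4) * s4 ^ v.length) := by
          rw [← ((commute_conjugator_s4 true v).inv_left.pow_right _).eq, ← mul_assoc (Δ3 ^ _), h2,
            pow_succ']
          simp only [mul_assoc]
      _ = _ := by
          rw [(commute_complement_s4 true v).eq]
          simp only [mul_assoc]
  rw [h, show 2 * v.length + 3 = v.length + 1 + 1 + 1 + v.length by ring]
  refine ((((inInterval_conjugator true v).mul ?_).mul ?_).mul ?_).mul
    (inInterval_complement true v)
  · exact inInterval_wordVal _ [1, 0, 2, 1, 3] [6, 4, 3, 6, 8, 7, 6, 4, 2, 0, 2, 4, 3] (by decide)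
  · exact inInterval_wordVal _ [2, 1, 0, 3, 2] [7, 6, 4, 3, 1, 4, 3, 8, 6, 4, 6] (by decide)
  · exact inInterval_wordVal _ [2, 1, 0, 3, 2, 1] [0, 6, 5, 3, 2, 3, 7, 5, 7] (by decide)

theorem isConj_mul_comm (x y : B5) : IsConj (x * y) (y * x) :=
  isConj_iff.2 ⟨x⁻¹, by group⟩

theorem base_eq (n : ℕ) :
    base n = s4 ^ 2 * (δ3 * s1 * s3 * δ3 * Δ3 ^ (n+1) * s4 ^ (2*n+3)) := by
  have h : wordVal [1, 0, 2, 3, 2] * wordVal [0, 2, 1, 0, 3] =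
      s4 ^ 2 * (δ3 * s1 * s3 * δ3 * s4 ^ 2) := by
    rw [← wordVal_append, wordVal_eq_of_moves [2, 1, 0, 4, 3, 4, 3, 2, 1, 6, 7] _
      [3, 3, 1, 0, 0, 2, 1, 0, 3, 3] (by decide)]
    simp [wordVal, δ3, s1, s2, s3, s4, mul_assoc, pow_two]
  rw [base, h, show 2 * n + 3 = 2 + (2 * n + 1) by ring, pow_add s4 2]
  simp only [mul_assoc]
  rw [← mul_assoc (s4 ^ 2) (Δ3 ^ _), ((commute_Δ3_s4.pow_pow (n + 1) 2).eq).symm]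
  simp only [mul_assoc]

theorem commute_δ3_s4 : Commute δ3 s4 := (commute_gen_sg_s4 false).mul_left (commute_gen_sg_s4 true)

theorem Δ3_sq : Δ3 ^ 2 = δ3 ^ 3 := by
  have h : wordVal [1, 0, 1, 1, 0, 1] = wordVal [1, 0, 1, 0, 1, 0] :=
    wordVal_eq_of_moves [3] _ _ (by decide)
  simpa [wordVal, Δ3, δ3, s1, s2, pow_succ, mul_assoc] using h

theorem isConj_T_base {k : ℕ} (hk : 1 ≤ k) : IsConj (T k) (base (2 * k - 2)) := by
  obtain ⟨j, rfl⟩ := Nat.exists_eq_add_of_le' hk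
  have hΔ : s1 * δ3 = Δ3 := gen_sg_mul true
  have h1 : T (j + 1) = δ3 ^ (3 * (j+1) + 1) * s4 ^ (2 * (j+1) + 2) * (s3 * s4 ^ (2 * j + 1)) := by
    rw [T, show 2 * (j + 1) - 1 = 2 * j + 1 by omega, mul_assoc]
  have h2 : s3 * s4 ^ (2 * j + 1) * (δ3 ^ (3 * (j+1) + 1) * s4 ^ (2 * (j+1) + 2)) =
      s1 * s3 * δ3 * Δ3 ^ (2 * j + 1) * s4 ^ (4 * j + 5) * δ3 := by
    have h13 : s1 * s3 = s3 * s1 := gen_comm 0 2 (by decide)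
    calc _ = s3 * (δ3 ^ (3 * (j+1) + 1) * s4 ^ (2 * j + 1)) * s4 ^ (2 * (j+1) + 2) := by
          rw [(commute_δ3_s4.pow_pow (3 * (j+1) + 1) (2 * j + 1)).eq]
          simp only [mul_assoc]
      _ = s3 * (Δ3 ^ (2 * (j + 1)) * δ3) * s4 ^ (4 * j + 5) := by
          rw [pow_succ, pow_mul, ← Δ3_sq, ← pow_mul, ← mul_assoc, mul_assoc _ (s4 ^ _), ← pow_add]
          congr 2
          ring
      _ = s3 * (s1 * δ3) * Δ3 ^ (2 * j + 1) * (δ3 * s4 ^ (4 * j + 5)) := by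
          rw [hΔ, show 2 * (j + 1) = (2 * j + 1) + 1 by ring, pow_succ']
          simp only [mul_assoc]
      _ = _ := by
          rw [(commute_δ3_s4.pow_right _).eq, h13]
          simp only [mul_assoc]
  have h3 : IsConj (T (j + 1)) (δ3 * (s1 * s3 * δ3 * Δ3 ^ (2 * j + 1) * s4 ^ (4 * j + 5))) := by
    rw [h1]
    refine (isConj_mul_comm _ _).trans ?_
    rw [h2]
    exact isConj_mul_comm _ _
  rw [show 2 * (j + 1) - 2 = 2 * j by omega, base_eq]
  refine (h3.trans ?_).trans (isConj_mul_comm _ _)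
  rw [show 4 * j + 5 = (2 * (2 * j) + 3) + 2 by ring, pow_add s4 _ 2]
  simp only [← mul_assoc]
  exact IsConj.refl _

/-! ### Injectivity -/

/-- The Burau matrices of the generators at `-1`. -/
def burau : Fin 4 → Matrix (Fin 4) (Fin 4) ℤ :=
  ![!![1, 1, 0, 0; 0, 1, 0, 0; 0, 0, 1, 0; 0, 0, 0, 1],
    !![1, 0, 0, 0; -1, 1, 1, 0; 0, 0, 1, 0; 0, 0, 0, 1],
    !![1, 0, 0, 0; 0, 1, 0, 0; 0, -1, 1, 1; 0, 0, 0, 1],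
    !![1, 0, 0, 0; 0, 1, 0, 0; 0, 0, 1, 0; 0, 0, -1, 1]]

theorem exists_burau_rep : ∃ ρ : B5 →* Matrix (Fin 4) (Fin 4) ℚ,
    ∀ i, ρ (gen i) = (Int.castRingHom ℚ).mapMatrix (burau i) :=
  exists_rep burau (fun i => (2 : ℤ) • 1 - burau i) 1
    (by norm_num) (by decide +kernel) (by decide +kernel) (by decide +kernel)

/-- The inner product of two rows, truncated to the first two columns. -/
def rowInner (M : Matrix (Fin 4) (Fin 4) ℚ) (i j : Fin 4) : ℚ := M i 0 * M j 0 + M i 1 * M j 1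

/-- The first two rows of `M` form a nonobtuse angle, or a nonacute one, depending on `f`. -/
structure RowAngle (f : Bool) (M : Matrix (Fin 4) (Fin 4) ℚ) : Prop where
  zero_left : M 2 0 = 0
  zero_right : M 2 1 = 0
  fst_pos : 0 < rowInner M 0 0
  snd_pos : 0 < rowInner M 1 1
  angle : if f then 0 ≤ rowInner M 0 1 else rowInner M 0 1 ≤ 0

theorem rho_gen_zero_mul {ρ : B5 →* Matrix (Fin 4) (Fin 4) ℚ}
    (hρ : ∀ i, ρ (gen i) = (Int.castRingHom ℚ).mapMatrix (burau i))
    (M : Matrix (Fin 4) (Fin 4) ℚ) (j : Fin 4) :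
    (ρ (gen 0) * M) 0 j = M 0 j + M 1 j ∧ (ρ (gen 0) * M) 1 j = M 1 j ∧
      (ρ (gen 0) * M) 2 j = M 2 j := by
  simp [hρ, Matrix.mul_apply, Fin.sum_univ_four, burau]

theorem rho_gen_one_mul {ρ : B5 →* Matrix (Fin 4) (Fin 4) ℚ}
    (hρ : ∀ i, ρ (gen i) = (Int.castRingHom ℚ).mapMatrix (burau i))
    (M : Matrix (Fin 4) (Fin 4) ℚ) (j : Fin 4) :
    (ρ (gen 1) * M) 0 j = M 0 j ∧ (ρ (gen 1) * M) 1 j = - M 0 j + M 1 j + M 2 j ∧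
      (ρ (gen 1) * M) 2 j = M 2 j := by
  simp [hρ, Matrix.mul_apply, Fin.sum_univ_four, burau]

theorem RowAngle.gen_mul {ρ : B5 →* Matrix (Fin 4) (Fin 4) ℚ}
    (hρ : ∀ i, ρ (gen i) = (Int.castRingHom ℚ).mapMatrix (burau i))
    {f : Bool} {M : Matrix (Fin 4) (Fin 4) ℚ} (h : RowAngle f M) :
    RowAngle f (ρ (gen (sg f)) * M) ∧
      if f then rowInner (ρ (gen (sg f)) * M) 1 1 < rowInner (ρ (gen (sg f)) * M) 0 0
      else rowInner (ρ (gen (sg f)) * M) 0 0 < rowInner (ρ (gen (sg f)) * M) 1 1 := by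
  obtain ⟨h1, h2, h3, h4, h5⟩ := h
  cases f
  · have e := rho_gen_one_mul hρ M
    simp only [rowInner, Bool.false_eq_true, if_false] at h3 h4 h5
    refine ⟨⟨?_, ?_, ?_, ?_, ?_⟩, ?_⟩ <;>
      simp only [sg, Bool.false_eq_true, if_false, rowInner, e, h1, h2] <;> nlinarith
  · have e := rho_gen_zero_mul hρ M
    simp only [rowInner, if_true] at h3 h4 h5
    refine ⟨⟨?_, ?_, ?_, ?_, ?_⟩, ?_⟩ <;>
      simp only [sg, if_true, rowInner, e, h1, h2] <;> nlinarith

theorem RowAngle.gen_mul_gen_mul {ρ : B5 →* Matrix (Fin 4) (Fin 4) ℚ}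
    (hρ : ∀ i, ρ (gen i) = (Int.castRingHom ℚ).mapMatrix (burau i))
    {f : Bool} {M : Matrix (Fin 4) (Fin 4) ℚ}
    (h : RowAngle (!f) M) :
    RowAngle f (ρ (gen (sg f)) * (ρ (gen (sg !f)) * M)) ∧
      if f then rowInner (ρ (gen (sg f)) * (ρ (gen (sg !f)) * M)) 0 0 <
        rowInner (ρ (gen (sg f)) * (ρ (gen (sg !f)) * M)) 1 1
      else rowInner (ρ (gen (sg f)) * (ρ (gen (sg !f)) * M)) 1 1 <
        rowInner (ρ (gen (sg f)) * (ρ (gen (sg !f)) * M)) 0 0 := by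
  obtain ⟨h1, h2, h3, h4, h5⟩ := h
  have e0 := rho_gen_zero_mul hρ
  have e1 := rho_gen_one_mul hρ
  cases f
  · simp only [rowInner, Bool.not_false, if_true] at h3 h4 h5
    refine ⟨⟨?_, ?_, ?_, ?_, ?_⟩, ?_⟩ <;>
      simp only [sg, Bool.false_eq_true, Bool.not_false, if_false, if_true, rowInner, e0, e1,
        h1, h2] <;> nlinarith
  · simp only [rowInner, Bool.not_true, Bool.false_eq_true, if_false] at h3 h4 h5
    refine ⟨⟨?_, ?_, ?_, ?_, ?_⟩, ?_⟩ <;>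
      simp only [sg, Bool.false_eq_true, Bool.not_true, if_false, if_true, rowInner, e0, e1,
        h1, h2] <;> nlinarith

theorem rowAngle_conjugator {ρ : B5 →* Matrix (Fin 4) (Fin 4) ℚ}
    (hρ : ∀ i, ρ (gen i) = (Int.castRingHom ℚ).mapMatrix (burau i))
    (f : Bool) (v : List Bool) : RowAngle f (ρ (conjugator f v)) := by
  induction v generalizing f with
  | nil =>
    rw [conjugator, map_one]
    refine ⟨?_, ?_, ?_, ?_, ?_⟩ <;> simp [rowInner]
  | cons b v ih =>
    cases b
    · rw [conjugator, map_mul, map_mul, mul_assoc]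
      exact ((ih !f).gen_mul_gen_mul hρ).1
    · rw [conjugator, map_mul]
      exact ((ih f).gen_mul hρ).1

theorem rho_conjugator_injective {ρ : B5 →* Matrix (Fin 4) (Fin 4) ℚ}
    (hρ : ∀ i, ρ (gen i) = (Int.castRingHom ℚ).mapMatrix (burau i))
    (f : Bool) (v w : List Bool) (hvw : v.length = w.length)
    (h : ρ (conjugator f v) = ρ (conjugator f w)) : v = w := by
  have hcancel : ∀ x y z : B5, ρ (x * y) = ρ (x * z) → ρ y = ρ z := by
    intro x y z h
    simpa [← map_mul] using congrArg (ρ x⁻¹ * ·) h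
  have hne : ∀ f v w, ρ (conjugator f (true :: v)) ≠ ρ (conjugator f (false :: w)) := by
    intro f v w h
    have h1 := ((rowAngle_conjugator hρ f v).gen_mul hρ).2
    have h2 := ((rowAngle_conjugator hρ (!f) w).gen_mul_gen_mul hρ).2
    rw [conjugator, conjugator, map_mul, map_mul, map_mul, mul_assoc] at h
    rw [h] at h1
    cases f
    · exact lt_asymm h1 h2
    · exact lt_asymm h1 h2
  induction v generalizing f w with
  | nil => exact (List.eq_nil_of_length_eq_zero hvw.symm).symm
  | cons b v ih =>
    cases w with
    | nil => simp at hvw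
    | cons c w =>
      have hvw' : v.length = w.length := by simpa using hvw
      cases b <;> cases c
      · rw [ih _ w hvw' (hcancel _ _ _ h)]
      · exact absurd h.symm (hne _ _ _)
      · exact absurd h (hne _ _ _)
      · rw [ih _ w hvw' (hcancel _ _ _ h)]

theorem rho_conjugator_mulVec {ρ : B5 →* Matrix (Fin 4) (Fin 4) ℚ}
    (hρ : ∀ i, ρ (gen i) = (Int.castRingHom ℚ).mapMatrix (burau i))
    (f : Bool) (v : List Bool) :
    (ρ (conjugator f v)).mulVec ![0, 0, 0, 1] = ![0, 0, 0, 1] := by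
  have hg : ∀ f, (ρ (gen (sg f))).mulVec ![0, 0, 0, 1] = ![0, 0, 0, 1] := by
    intro f
    ext i
    cases f <;> fin_cases i <;>
      simp [sg, hρ, burau, Matrix.mulVec, dotProduct, Fin.sum_univ_four]
  induction v generalizing f with
  | nil => simp [conjugator]
  | cons b v ih =>
    cases b
    · rw [conjugator, map_mul, map_mul, ← Matrix.mulVec_mulVec, ih, ← Matrix.mulVec_mulVec, hg, hg]
    · rw [conjugator, map_mul, ← Matrix.mulVec_mulVec, ih, hg]

theorem rho_eq_or {ρ : B5 →* Matrix (Fin 4) (Fin 4) ℚ}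
    (hρ : ∀ i, ρ (gen i) = (Int.castRingHom ℚ).mapMatrix (burau i))
    (j : ℕ) :
    ρ (δ3 * s1 * s3 * δ3 * Δ3 ^ (2 * j + 1)) =
        !![-1, -1, 2, 0; 1, 1, -1, 1; 0, 1, 1, 1; 0, 0, 0, 1] ∨
      ρ (δ3 * s1 * s3 * δ3 * Δ3 ^ (2 * j + 1)) =
        !![1, 1, 0, 0; -1, -1, 1, 1; 0, -1, 1, 1; 0, 0, 0, 1] := by
  set ι := (Int.castRingHom ℚ).mapMatrix (m := Fin 4)
  have h4 : ρ (Δ3 ^ 4) = 1 := by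
    have : ρ (Δ3 ^ 4) = ι ((burau 1 * burau 0 * burau 1) ^ 4) := by
      simp only [Δ3, s1, s2, map_mul, map_pow, hρ, ι]
    rw [this, show (burau 1 * burau 0 * burau 1) ^ 4 = 1 by decide +kernel, map_one]
  have hred : ∀ i r, ρ (δ3 * s1 * s3 * δ3 * Δ3 ^ (4 * i + r)) =
      ι (burau 1 * burau 0 * burau 0 * burau 2 * (burau 1 * burau 0) *
        (burau 1 * burau 0 * burau 1) ^ r) := by
    intro i r
    rw [pow_add, pow_mul, map_mul, map_mul ρ (_ ^ i), map_pow ρ, h4, one_pow, one_mul]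
    simp only [δ3, Δ3, s1, s2, s3, map_mul, map_pow, hρ, ι]
  have hmap : ∀ A : Matrix (Fin 4) (Fin 4) ℤ, ι A = A.map (fun x => (x : ℚ)) := fun _ => rfl
  obtain ⟨i, rfl | rfl⟩ := j.even_or_odd'
  · left
    rw [show 2 * (2 * i) + 1 = 4 * i + 1 by ring, hred]
    rw [show burau 1 * burau 0 * burau 0 * burau 2 * (burau 1 * burau 0) *
      (burau 1 * burau 0 * burau 1) ^ 1 =
      !![-1, -1, 2, 0; 1, 1, -1, 1; 0, 1, 1, 1; 0, 0, 0, 1] by decide +kernel, hmap]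
    ext a b
    fin_cases a <;> fin_cases b <;> simp
  · right
    rw [show 2 * (2 * i + 1) + 1 = 4 * i + 3 by ring, hred]
    rw [show burau 1 * burau 0 * burau 0 * burau 2 * (burau 1 * burau 0) *
      (burau 1 * burau 0 * burau 1) ^ 3 =
      !![1, 1, 0, 0; -1, -1, 1, 1; 0, -1, 1, 1; 0, 0, 0, 1] by decide +kernel, hmap]
    ext a b
    fin_cases a <;> fin_cases b <;> simp

/-- A matrix that fixes a cyclic vector of a matrix commuting with it is the identity. -/
theorem eq_one_of_commute {H G : Matrix (Fin 4) (Fin 4) ℚ} (hHG : Commute H G)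
    (hH : H.mulVec ![0, 0, 0, 1] = ![0, 0, 0, 1])
    (hG : G = !![-1, -1, 2, 0; 1, 1, -1, 1; 0, 1, 1, 1; 0, 0, 0, 1] ∨
      G = !![1, 1, 0, 0; -1, -1, 1, 1; 0, -1, 1, 1; 0, 0, 0, 1]) : H = 1 := by
  have step : ∀ v w, G.mulVec v = w → H.mulVec v = v → H.mulVec w = w := by
    rintro v w rfl hv
    rw [Matrix.mulVec_mulVec, hHG.eq, ← Matrix.mulVec_mulVec, hv]
  obtain hG | hG := hG
  · have h1 := step _ ![0, 1, 1, 1] (by rw [hG]; decide +kernel) hH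
    have h2 := step _ ![1, 1, 3, 1] (by rw [hG]; decide +kernel) h1
    have h3 := step _ ![4, 0, 5, 1] (by rw [hG]; decide +kernel) h2
    ext i j
    have e0 := congrFun hH i
    have e1 := congrFun h1 i
    have e2 := congrFun h2 i
    have e3 := congrFun h3 i
    simp only [Matrix.mulVec, dotProduct, Fin.sum_univ_four] at e0 e1 e2 e3
    fin_cases i <;> fin_cases j <;> simp at e0 e1 e2 e3 ⊢ <;> linarith
  · have h1 := step _ ![0, 1, 1, 1] (by rw [hG]; decide +kernel) hH
    have h2 := step _ ![1, 1, 1, 1] (by rw [hG]; decide +kernel) h1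
    have h3 := step _ ![2, 0, 1, 1] (by rw [hG]; decide +kernel) h2
    ext i j
    have e0 := congrFun hH i
    have e1 := congrFun h1 i
    have e2 := congrFun h2 i
    have e3 := congrFun h3 i
    simp only [Matrix.mulVec, dotProduct, Fin.sum_univ_four] at e0 e1 e2 e3
    fin_cases i <;> fin_cases j <;> simp at e0 e1 e2 e3 ⊢ <;> linarith

theorem family_injective {n : ℕ} (hn : Even n) {v w : List Bool} (hvw : v.length = w.length)
    (h : family n v = family n w) : v = w := by
  obtain ⟨j, rfl⟩ := even_iff_exists_two_mul.1 hn
  obtain ⟨ρ, hρ⟩ := exists_burau_rep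
  set g := (conjugator true w)⁻¹ * conjugator true v with hg
  have hgs : ∀ m, Commute g (s4 ^ m) := fun m =>
    ((commute_conjugator_s4 true w).inv_left.mul_left (commute_conjugator_s4 true v)).pow_right m
  have hgb : Commute g (base (2 * j)) := by
    have h1 : Commute g (s4 ^ (2 * j) * base (2 * j) * (s4 ^ (2 * j))⁻¹) := by
      have h2 := congrArg (fun x => (conjugator true w)⁻¹ * x * conjugator true v) h
      simp only [family, mul_inv_rev] at h2
      rw [Commute, SemiconjBy, hg]
      simpa [mul_assoc] using h2
    have h3 := ((hgs (2 * j)).inv_right.mul_right h1).mul_right (hgs (2 * j))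
    simpa [mul_assoc] using h3
  have hgG : Commute g (δ3 * s1 * s3 * δ3 * Δ3 ^ (2 * j + 1)) := by
    rw [base_eq] at hgb
    have h3 := ((hgs 2).inv_right.mul_right hgb).mul_right (hgs (2 * (2 * j) + 3)).inv_right
    rwa [inv_mul_cancel_left, mul_inv_cancel_right] at h3
  have hfix : (ρ g).mulVec ![0, 0, 0, 1] = ![0, 0, 0, 1] := by
    rw [hg, map_mul, ← Matrix.mulVec_mulVec, rho_conjugator_mulVec hρ]
    conv_lhs => rw [← rho_conjugator_mulVec hρ true w]
    rw [Matrix.mulVec_mulVec, ← map_mul, inv_mul_cancel, map_one, Matrix.one_mulVec]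
  have hone : ρ g = 1 := eq_one_of_commute (hgG.map ρ) hfix (rho_eq_or hρ j)
  refine rho_conjugator_injective hρ true v w hvw ?_
  rw [← mul_one (ρ (conjugator true w)), ← hone, ← map_mul, hg, mul_inv_cancel_left]

/-- the super summit set of `T_k` has cardinality at least `2^{2k-2}`:
there is an injective map from `{1,2}^{2k-2}` into the set of conjugates of `T_k`
of minimal canonical length. -/
theorem SSS_cardinality_lower_bound (k : ℕ) (hk : 2 ≤ k) :
    ∃ F : (Fin (2*k-2) → Fin 2) → B5, Function.Injective F ∧
      ∀ v, IsConj (T k) (F v) ∧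
        ∀ z : B5, IsConj (T k) z → canLen (F v) ≤ canLen z := by
  refine ⟨fun v => family (2 * k - 2) (List.ofFn fun i => decide (v i = 0)), ?_, fun v => ⟨?_, ?_⟩⟩
  · intro v w h
    have h' := List.ofFn_injective (family_injective ⟨k - 1, by omega⟩ (by simp) h)
    funext i
    have := congrFun h' i
    rw [decide_eq_decide] at this
    omega
  · exact (isConj_T_base (by omega)).trans (isConj_iff.2 ⟨_, rfl⟩)
  · intro z hz
    have h1 := canLen_le_of_inInterval (inInterval_family (List.ofFn fun i => decide (v i = 0)))
    rw [List.length_ofFn] at h1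
    exact h1.trans (le_canLen (fun p hp => hp.nonpos_of_isConj_T hk hz) fun q hq =>
      le_of_isConj_base_of_pre (by omega) ((isConj_T_base (by omega)).symm.trans hz) hq)
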